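/- Let G be a connected simple graph on n ≥ 2 vertices. Then ρ(D^L(G)) ≥ n, with equality if and only if G is the complete graph K_n. -/

import Mathlib

open Matrix BigOperators

/-- The distance matrix of a graph: the `(u,v)` entry is the graph distance from `u` to `v`. -/
noncomputable def distMatrix {V : Type*} [Fintype V] (G : SimpleGraph V) : Matrix V V ℝ :=
  Matrix.of fun u v => (G.dist u v : ℝ)

/-- The transmission of a vertex: the sum of the distances to all vertices. -/
noncomputable def transmission {V : Type*} [Fintype V] (G : SimpleGraph V) (v : V) : ℝ :=
  ∑ u, (G.dist v u : ℝ)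

/-- The distance signless Laplacian `D^Q(G) = T(G) + D(G)`. -/
noncomputable def distSignlessLap {V : Type*} [Fintype V] [DecidableEq V] (G : SimpleGraph V) :
    Matrix V V ℝ :=
  Matrix.diagonal (transmission G) + distMatrix G

/-- The distance Laplacian `D^L(G) = T(G) - D(G)`. -/
noncomputable def distLap {V : Type*} [Fintype V] [DecidableEq V] (G : SimpleGraph V) :
    Matrix V V ℝ :=
  Matrix.diagonal (transmission G) - distMatrix G

/-- The normalized distance Laplacian `D^NL(G) = T(G)^{-1/2} D^L(G) T(G)^{-1/2}`. -/
noncomputable def normDistLap {V : Type*} [Fintype V] [DecidableEq V] (G : SimpleGraph V) :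
    Matrix V V ℝ :=
  Matrix.diagonal (fun v => (Real.sqrt (transmission G v))⁻¹) * distLap G *
    Matrix.diagonal (fun v => (Real.sqrt (transmission G v))⁻¹)

/-- The spectral radius of a real matrix: the supremum of absolute values of its
(real) eigenvalues. -/
noncomputable def specRad {V : Type*} [Fintype V] [DecidableEq V] (M : Matrix V V ℝ) : ℝ :=
  sSup (abs '' spectrum ℝ M)

/-- The vector `e_u - e_v`. -/
noncomputable def signVec {V : Type*} [DecidableEq V] (u v : V) : V → ℝ :=
  Pi.single u 1 - Pi.single v 1

section RayleighBound

variable {V : Type*} [Fintype V] [DecidableEq V]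

theorem abs_le_specRad {M : Matrix V V ℝ} {μ : ℝ} (h : μ ∈ spectrum ℝ M) : |μ| ≤ specRad M :=
  le_csSup (M.finite_real_spectrum.image abs).bddAbove (Set.mem_image_of_mem abs h)

theorem Matrix.IsHermitian.posSemidef_algebraMap_specRad_sub {M : Matrix V V ℝ}
    (hM : M.IsHermitian) : (algebraMap ℝ (Matrix V V ℝ) (specRad M) - M).PosSemidef := by
  rw [posSemidef_iff_isHermitian_and_spectrum_nonneg]
  refine ⟨?_, ?_⟩
  · rw [Matrix.algebraMap_eq_diagonal]
    exact (isHermitian_diagonal _).sub hM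
  · rw [← spectrum.singleton_sub_eq]
    rintro _ ⟨_, rfl, μ, hμ, rfl⟩
    exact sub_nonneg.2 ((le_abs_self μ).trans (abs_le_specRad hμ))

/-- The Rayleigh quotient of a real symmetric matrix is at most its spectral radius. -/
theorem Matrix.IsHermitian.dotProduct_mulVec_le_specRad {M : Matrix V V ℝ}
    (hM : M.IsHermitian) (x : V → ℝ) : x ⬝ᵥ (M *ᵥ x) ≤ specRad M * (x ⬝ᵥ x) := by
  have h := hM.posSemidef_algebraMap_specRad_sub.dotProduct_mulVec_nonneg x
  rw [Algebra.algebraMap_eq_smul_one, sub_mulVec, smul_mulVec, one_mulVec, dotProduct_sub,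
    dotProduct_smul, star_trivial, smul_eq_mul] at h
  linarith

end RayleighBound

section DistLap

variable {V : Type*} [Fintype V] [DecidableEq V] {G : SimpleGraph V}

theorem isHermitian_distLap (G : SimpleGraph V) : (distLap G).IsHermitian := by
  refine (isHermitian_diagonal _).sub ?_
  ext u v
  simp [distMatrix, G.dist_comm]

theorem signVec_dotProduct_self {u v : V} (huv : u ≠ v) : signVec u v ⬝ᵥ signVec u v = 2 := by
  simp [signVec, huv, huv.symm]
  norm_num

theorem signVec_dotProduct_distLap_mulVec {u v : V} (huv : u ≠ v) :
    signVec u v ⬝ᵥ (distLap G *ᵥ signVec u v) =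
      transmission G u + transmission G v + 2 * G.dist u v := by
  simp [signVec, sub_dotProduct, mulVec_sub, distLap, distMatrix, huv, huv.symm,
    G.dist_comm (u := v) (v := u)]
  ring

theorem SimpleGraph.Connected.card_sub_two_add_dist_le_transmission (hG : G.Connected) {u v : V}
    (huv : u ≠ v) : (Fintype.card V : ℝ) - 2 + G.dist u v ≤ transmission G u := by
  have h : ∑ w, ((1 : ℝ) - (if w = u then 1 else 0) + if w = v then (G.dist u v : ℝ) - 1 else 0)
      ≤ transmission G u := by
    refine Finset.sum_le_sum fun w _ => ?_
    rcases eq_or_ne w u with rfl | hwu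
    · simp [huv]
    · rcases eq_or_ne w v with rfl | hwv
      · simp [hwu]
      · have := hG.pos_dist_of_ne hwu.symm
        simpa [hwu, hwv, Nat.one_le_iff_ne_zero] using this.ne'
  simp only [Finset.sum_add_distrib, Finset.sum_sub_distrib, Finset.sum_const, Finset.sum_ite_eq',
    Finset.mem_univ, if_true, Finset.card_univ, nsmul_eq_mul, mul_one] at h
  linarith

theorem SimpleGraph.Connected.card_sub_two_add_two_mul_dist_le_specRad_distLap (hG : G.Connected)
    {u v : V} (huv : u ≠ v) :
    (Fintype.card V : ℝ) - 2 + 2 * G.dist u v ≤ specRad (distLap G) := by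
  have h := (isHermitian_distLap G).dotProduct_mulVec_le_specRad (signVec u v)
  rw [signVec_dotProduct_distLap_mulVec huv, signVec_dotProduct_self huv] at h
  have hu := hG.card_sub_two_add_dist_le_transmission huv
  have hv := hG.card_sub_two_add_dist_le_transmission huv.symm
  rw [G.dist_comm] at hv
  linarith

theorem distLap_top_mulVec (x : V → ℝ) (v : V) :
    (distLap (⊤ : SimpleGraph V) *ᵥ x) v = Fintype.card V * x v - ∑ u, x u := by
  have ht : transmission (⊤ : SimpleGraph V) v = Fintype.card V - 1 := by
    have h (u : V) : (((⊤ : SimpleGraph V).dist v u : ℕ) : ℝ) = 1 - if v = u then 1 else 0 := by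
      rw [SimpleGraph.dist_top]; split_ifs <;> simp
    simp [transmission, h]
  have hD : (distMatrix (⊤ : SimpleGraph V) *ᵥ x) v = (∑ u, x u) - x v := by
    have h (u : V) : (((⊤ : SimpleGraph V).dist v u : ℕ) : ℝ) * x u =
        x u - if v = u then x u else 0 := by
      rw [SimpleGraph.dist_top]; split_ifs <;> simp
    simp [distMatrix, mulVec, dotProduct, h]
  rw [distLap, sub_mulVec, Pi.sub_apply, mulVec_diagonal, ht, hD]
  ring

theorem specRad_distLap_top_le : specRad (distLap (⊤ : SimpleGraph V)) ≤ Fintype.card V := by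
  refine Real.sSup_le ?_ (Nat.cast_nonneg _)
  rintro _ ⟨μ, hμ, rfl⟩
  rw [← Matrix.spectrum_toLin', ← Module.End.hasEigenvalue_iff_mem_spectrum] at hμ
  obtain ⟨x, hx⟩ := hμ.exists_hasEigenvector
  have hev (v : V) : (Fintype.card V : ℝ) * x v - ∑ u, x u = μ * x v := by
    rw [← distLap_top_mulVec, ← toLin'_apply, hx.apply_eq_smul, Pi.smul_apply, smul_eq_mul]
  have hsum : μ * ∑ v, x v = 0 := by
    rw [Finset.mul_sum, ← Finset.sum_congr rfl fun v _ => hev v, Finset.sum_sub_distrib,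
      ← Finset.mul_sum]
    simp
  rcases mul_eq_zero.1 hsum with h | h
  · simp [h]
  · obtain ⟨v, hv⟩ := Function.ne_iff.1 hx.2
    have hμ' : (Fintype.card V : ℝ) = μ := mul_right_cancel₀ hv (by simpa [h] using hev v)
    simp [← hμ']

end DistLap

/-- For a connected graph on `n ≥ 2` vertices, the spectral radius of the distance Laplacian
is at least `n`, with equality if and only if the graph is complete. -/
theorem specRad_distLap_ge_of_connected {n : ℕ} (hn : 2 ≤ n) (G : SimpleGraph (Fin n))
    (hG : G.Connected) :
    (n : ℝ) ≤ specRad (distLap G) ∧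
    (specRad (distLap G) = (n : ℝ) ↔ G = ⊤) := by
  have hle : (n : ℝ) ≤ specRad (distLap G) := by
    have : Nontrivial (Fin n) := Fin.nontrivial_iff_two_le.2 hn
    obtain ⟨u, v, huv⟩ := exists_pair_ne (Fin n)
    have h := hG.card_sub_two_add_two_mul_dist_le_specRad_distLap huv
    have hd : (1 : ℝ) ≤ G.dist u v := by exact_mod_cast hG.pos_dist_of_ne huv
    rw [Fintype.card_fin] at h
    linarith
  refine ⟨hle, fun heq => ?_, ?_⟩
  · refine SimpleGraph.eq_top_iff_forall_ne_adj.2 fun u v huv => ?_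
    by_contra hadj
    have h := hG.card_sub_two_add_two_mul_dist_le_specRad_distLap huv
    have hd : (1 : ℝ) < G.dist u v := by exact_mod_cast hG.one_lt_dist_of_ne_of_not_adj huv hadj
    rw [Fintype.card_fin, heq] at h
    linarith
  · rintro rfl
    exact le_antisymm (by simpa using specRad_distLap_top_le (V := Fin n)) hle
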